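/- arXiv:2407.09693 — 3 statements merged into one kernel-verified Lean document; each statement's English description precedes it below -/
import Mathlib

section
/- Quantitative stability of approximate minimizers (the paper's Theorem A.8, after Bonnans–Shapiro): Let E be a real inner product space, Ω ⊆ E nonempty, and f₁, f₂ : E → ℝ. Suppose S ⊆ Ω is a nonempty set of minimizers of f₁ over Ω with optimal value f₁* = inf_{x ∈ Ω} f₁(x); suppose there is a set N ⊇ S and a constant α > 0 such that f₁(x) ≥ f₁* + α·(dist(x, S))² for all x ∈ Ω ∩ N; suppose the difference Δ = f₂ − f₁ is L-Lipschitz on Ω ∩ N; and suppose x* ∈ Ω ∩ N satisfies f₂(x*) ≤ inf_{x ∈ Ω} f₂(x) + δ for some δ ≥ 0. Then dist(x*, S) ≤ L/α + √(δ/α). -/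
/-- A nonnegative affine bound that holds at the distance to every point of a nonempty set also
holds at the distance to the set. -/
theorem le_mul_infDist_add {X : Type*} [PseudoMetricSpace X] {S : Set X} (hS : S.Nonempty)
    {x : X} {c L δ : ℝ} (hL : 0 ≤ L) (h : ∀ s ∈ S, c ≤ L * dist x s + δ) :
    c ≤ L * Metric.infDist x S + δ := by
  refine le_of_forall_pos_le_add fun ε hε => ?_
  have hL' : 0 < L + 1 := by linarith
  obtain ⟨s, hs, hlt⟩ := (Metric.infDist_lt_iff hS).1
    (lt_add_of_pos_right (Metric.infDist x S) (div_pos hε hL'))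
  have hmul : L * dist x s ≤ L * (Metric.infDist x S + ε / (L + 1)) := by gcongr
  have hε' : (L + 1) * (ε / (L + 1)) = ε := mul_div_cancel₀ ε hL'.ne'
  have := div_pos hε hL'
  linarith [h s hs]

/-- A real number `d` with `α * d ^ 2 ≤ L * d + δ` is at most `L / α + √(δ / α)`. -/
theorem le_div_add_sqrt_of_mul_sq_le {α L δ d : ℝ} (hα : 0 < α) (hL : 0 ≤ L) (hδ : 0 ≤ δ)
    (h : α * d ^ 2 ≤ L * d + δ) : d ≤ L / α + √(δ / α) := by
  have hq : √(δ / α) ^ 2 = δ / α := Real.sq_sqrt (by positivity)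
  have hdiv : d ^ 2 ≤ L / α * d + √(δ / α) ^ 2 := by
    rw [hq, div_mul_eq_mul_div, ← add_div, le_div_iff₀ hα]
    linarith
  have ha : 0 ≤ L / α := by positivity
  have hq0 := Real.sqrt_nonneg (δ / α)
  by_contra! hlt
  have hd : 0 < d := by linarith
  nlinarith [mul_pos hd (sub_pos.2 hlt), mul_nonneg hq0 (by linarith : 0 ≤ d - √(δ / α))]

/-- Quantitative stability of approximate minimizers (Bonnans–Shapiro):
if `S ⊆ Ω` is a nonempty set of minimizers of `f₁` over `Ω` with optimal value `f₁star`,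
the second-order growth condition holds on `Ω ∩ N` with constant `α`, the difference
`f₂ - f₁` is `L`-Lipschitz on `Ω ∩ N`, and `xstar ∈ Ω ∩ N` is a `δ`-solution of
minimizing `f₂` over `Ω`, then `dist(xstar, S) ≤ L/α + √(δ/α)`. -/
theorem approximate_minimizer_stability
    {E : Type*} [NormedAddCommGroup E] [InnerProductSpace ℝ E]
    (Ω S N : Set E) (hΩ : Ω.Nonempty) (hSne : S.Nonempty) (hSΩ : S ⊆ Ω) (hSN : S ⊆ N)
    (α L δ : ℝ) (hα : 0 < α) (hL : 0 ≤ L) (hδ : 0 ≤ δ)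
    (f₁ f₂ : E → ℝ) (f₁star : ℝ)
    (hSmin : ∀ s ∈ S, f₁ s = f₁star)
    (hf₁star : ∀ x ∈ Ω, f₁star ≤ f₁ x)
    (hgrowth : ∀ x ∈ Ω ∩ N, f₁star + α * (Metric.infDist x S) ^ 2 ≤ f₁ x)
    (hlip : ∀ x ∈ Ω ∩ N, ∀ y ∈ Ω ∩ N, |(f₂ x - f₁ x) - (f₂ y - f₁ y)| ≤ L * ‖x - y‖)
    (xstar : E) (hxstar : xstar ∈ Ω ∩ N)
    (hδsol : ∀ x ∈ Ω, f₂ xstar ≤ f₂ x + δ) :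
    Metric.infDist xstar S ≤ L / α + Real.sqrt (δ / α) := by
  refine le_div_add_sqrt_of_mul_sq_le hα hL hδ ?_
  refine le_mul_infDist_add hSne hL fun s hs => ?_
  have hlip_s := (abs_le.1 (hlip xstar hxstar s ⟨hSΩ hs, hSN hs⟩)).1
  rw [dist_eq_norm]
  linarith [hgrowth xstar hxstar, hδsol s (hSΩ hs), hSmin s hs]
end

section
/- Differentiability of the optimal value function in the weights with gradient given by the features at the minimizer (third claim of the paper's Theorem 11, in instantiated form): Let Ω ⊆ ℝ^n be compact and nonempty, and let Φ : ℝ^n → ℝ^r and p : ℝ^n → ℝ be continuous. Define V(w) = min_{ν ∈ Ω} (⟨w, Φ(ν)⟩ + p(ν)). Fix w₀ ∈ ℝ^r and suppose the minimizer at w₀ is unique, i.e., there is exactly one ν* ∈ Ω with ⟨w₀, Φ(ν*)⟩ + p(ν*) = V(w₀). Then V is differentiable at w₀ and ∇V(w₀) = Φ(ν*). -/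
open scoped RealInnerProductSpace

open Filter Topology in
/-- If `x₀` is the only minimizer of `f w₀` over a compact set `K`, then for `w` near `w₀` every
minimizer of `f w` over `K` lies in a prescribed neighbourhood of `x₀`. -/
theorem IsCompact.eventually_forall_isMinOn_mem {W X : Type*} [TopologicalSpace W]
    [TopologicalSpace X] {K : Set X} (hK : IsCompact K) {f : W → X → ℝ}
    (hf : Continuous fun q : W × X => f q.1 q.2) {w₀ : W} {x₀ : X} (hx₀ : x₀ ∈ K)
    (hlt : ∀ x ∈ K, x ≠ x₀ → f w₀ x₀ < f w₀ x) {U : Set X} (hU : IsOpen U) (hxU : x₀ ∈ U) :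
    ∀ᶠ w in 𝓝 w₀, ∀ x ∈ K, IsMinOn (f w) K x → x ∈ U := by
  have hfx₀ : Continuous fun q : W × X => f q.1 x₀ :=
    hf.comp (continuous_fst.prodMk continuous_const)
  have hev : ∀ᶠ w in 𝓝 w₀, ∀ x ∈ K \ U, f w x₀ < f w x := by
    refine (hK.diff hU).eventually_forall_of_forall_eventually fun x hx => ?_
    exact hfx₀.continuousAt.eventually_lt hf.continuousAt
      (hlt x hx.1 fun h => hx.2 (h ▸ hxU))
  filter_upwards [hev] with w hw x hx hmin
  by_contra hxnU
  exact (hw x ⟨hx, hxnU⟩).not_ge (hmin hx₀)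

/-- Differentiability of the optimal value function in the weights with gradient given
by the features at the unique minimizer: if `V(w) = min_{ν ∈ Ω} (⟨w, Φ(ν)⟩ + p(ν))`
over a compact nonempty `Ω` with `Φ`, `p` continuous, and the minimizer `ν⋆` at `w₀`
is unique, then `V` is differentiable at `w₀` with `∇V(w₀) = Φ(ν⋆)`. -/
theorem weighted_value_function_gradient {n r : ℕ}
    (Ω : Set (EuclideanSpace ℝ (Fin n))) (hΩc : IsCompact Ω) (hΩne : Ω.Nonempty)
    (Φ : EuclideanSpace ℝ (Fin n) → EuclideanSpace ℝ (Fin r))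
    (p : EuclideanSpace ℝ (Fin n) → ℝ)
    (hΦ : Continuous Φ) (hp : Continuous p)
    (V : EuclideanSpace ℝ (Fin r) → ℝ)
    (hV : ∀ w, V w = sInf ((fun ν => ⟪w, Φ ν⟫ + p ν) '' Ω))
    (w₀ : EuclideanSpace ℝ (Fin r)) (νstar : EuclideanSpace ℝ (Fin n))
    (hmem : νstar ∈ Ω)
    (hopt : ⟪w₀, Φ νstar⟫ + p νstar = V w₀)
    (huniq : ∀ ν ∈ Ω, ⟪w₀, Φ ν⟫ + p ν = V w₀ → ν = νstar) :
    HasGradientAt V (Φ νstar) w₀ := by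
  have hf : Continuous fun q : EuclideanSpace ℝ (Fin r) × EuclideanSpace ℝ (Fin n) =>
      ⟪q.1, Φ q.2⟫ + p q.2 := by fun_prop
  have hfw (w : EuclideanSpace ℝ (Fin r)) : Continuous fun ν => ⟪w, Φ ν⟫ + p ν := by fun_prop
  have hle (w : EuclideanSpace ℝ (Fin r)) : ∀ ν ∈ Ω, V w ≤ ⟪w, Φ ν⟫ + p ν := fun ν hν => by
    rw [hV]
    exact csInf_le (hΩc.image (hfw w)).bddBelow (Set.mem_image_of_mem _ hν)
  have hlt : ∀ ν ∈ Ω, ν ≠ νstar → ⟪w₀, Φ νstar⟫ + p νstar < ⟪w₀, Φ ν⟫ + p ν := by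
    intro ν hν hne
    rw [hopt]
    exact lt_of_le_of_ne (hle w₀ ν hν) fun h => hne (huniq ν hν h.symm)
  rw [hasGradientAt_iff_isLittleO, Asymptotics.isLittleO_iff]
  intro c hc
  have hU : IsOpen {ν | ‖Φ ν - Φ νstar‖ < c} :=
    isOpen_lt (hΦ.sub continuous_const).norm continuous_const
  filter_upwards [hΩc.eventually_forall_isMinOn_mem (f := fun w ν => ⟪w, Φ ν⟫ + p ν) hf hmem hlt
    hU (by simpa using hc)] with w hw
  obtain ⟨ν, hν, hνV⟩ := (hΩc.image (hfw w)).sInf_mem (hΩne.image _)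
  rw [← hV] at hνV
  have hclose : ‖Φ ν - Φ νstar‖ < c :=
    hw ν hν fun μ hμ => hνV.trans_le (hle w μ hμ)
  have hupper := hle w νstar hmem
  have hlower := hle w₀ ν hν
  have hcs : |⟪Φ ν - Φ νstar, w - w₀⟫| ≤ c * ‖w - w₀‖ :=
    (abs_real_inner_le_norm _ _).trans (by gcongr)
  have hbound := (abs_le.mp hcs).1
  rw [Real.norm_eq_abs, abs_le]
  simp only [inner_sub_right, real_inner_comm w, real_inner_comm w₀]
    at hbound hνV hupper hlower hopt ⊢
  have hnonneg : 0 ≤ c * ‖w - w₀‖ := by positivity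
  constructor <;> linarith
end

section
/- Lipschitz continuity of the minimizer of a parametric strongly convex quadratic program in the weights (first claim of the paper's Theorem 11, in instantiated form): Let n, r be positive integers, C > 0, ε > 0, and Ω ⊆ ℝ^n nonempty, closed, convex, and contained in the closed Euclidean ball of radius C centered at 0. Let D : ℝ^r → (n×n real matrices) and c : ℝ^r → ℝ^n be linear maps such that D(w) is symmetric positive semidefinite whenever w has nonnegative entries, ‖D(w)‖_op ≤ ‖w‖₂ for all w (operator norm), and ‖c(w)‖₂ ≤ ‖w‖₂ for all w. For each w ∈ ℝ^r with nonnegative entries, let ν*(w) denote the unique minimizer over Ω of ν ↦ νᵀ(D(w) + εI)ν + ⟨c(w), ν⟩ (which exists and is unique since the objective is ε-strongly convex and Ω is nonempty, closed, and convex). Then for all w₁, w₂ ∈ ℝ^r with nonnegative entries, ‖ν*(w₂) − ν*(w₁)‖ ≤ ((1 + 2C)/ε)·‖w₂ − w₁‖₂. -/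
open scoped RealInnerProductSpace

section QuadraticProgram

variable {E : Type*} [NormedAddCommGroup E] [InnerProductSpace ℝ E]

/-- A nonnegative quadratic polynomial on `(0, 1]` without constant term has nonnegative
linear coefficient. -/
theorem nonneg_of_forall_mul_add_sq_mul_nonneg {a b : ℝ}
    (h : ∀ t : ℝ, 0 < t → t ≤ 1 → 0 ≤ t * a + t ^ 2 * b) : 0 ≤ a := by
  by_contra! ha
  have hpos : 0 < |b| - a := by linarith [abs_nonneg b]
  have hb : 0 < 2 * (|b| - a) := by linarith
  have key := h (-a / (2 * (|b| - a))) (div_pos (by linarith) hb)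
    ((div_le_one hb).2 (by linarith [abs_nonneg b]))
  set t := -a / (2 * (|b| - a)) with ht
  have ht0 : 0 < t := div_pos (by linarith) hb
  have hta : t * (2 * (|b| - a)) = -a := div_mul_cancel₀ _ hb.ne'
  have hsum : 0 ≤ a + t * b := by
    refine nonneg_of_mul_nonneg_right (a := t) ?_ ht0
    linarith [show t * (a + t * b) = t * a + t ^ 2 * b by ring]
  nlinarith [mul_le_mul_of_nonneg_left (le_abs_self b) ht0.le, mul_pos ht0 (neg_pos.2 ha)]

/-- Quadratic growth of a regularized convex quadratic objective at its minimizer over a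
convex set. -/
theorem quadratic_growth_of_minimizer {Ω : Set E} (hΩ : Convex ℝ Ω) {A : E →L[ℝ] E} {b x y : E}
    {ε : ℝ} (hA : ∀ v, 0 ≤ ⟪A v, v⟫) (hx : x ∈ Ω) (hy : y ∈ Ω)
    (hmin : ∀ v ∈ Ω, ⟪x, A x⟫ + ε * ‖x‖ ^ 2 + ⟪b, x⟫ ≤ ⟪v, A v⟫ + ε * ‖v‖ ^ 2 + ⟪b, v⟫) :
    ⟪x, A x⟫ + ε * ‖x‖ ^ 2 + ⟪b, x⟫ + ε * ‖y - x‖ ^ 2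
      ≤ ⟪y, A y⟫ + ε * ‖y‖ ^ 2 + ⟪b, y⟫ := by
  have expand : ∀ t : ℝ, ⟪x + t • (y - x), A (x + t • (y - x))⟫ + ε * ‖x + t • (y - x)‖ ^ 2
      + ⟪b, x + t • (y - x)⟫ = ⟪x, A x⟫ + ε * ‖x‖ ^ 2 + ⟪b, x⟫
      + (t * (⟪x, A (y - x)⟫ + ⟪y - x, A x⟫ + 2 * ε * ⟪x, y - x⟫ + ⟪b, y - x⟫)
        + t ^ 2 * (⟪A (y - x), y - x⟫ + ε * ‖y - x‖ ^ 2)) := by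
    intro t
    generalize y - x = d
    rw [norm_add_sq_real, norm_smul, mul_pow, Real.norm_eq_abs, sq_abs,
      real_inner_comm d (A d)]
    simp only [map_add, map_smul, inner_add_left, inner_add_right, real_inner_smul_left,
      real_inner_smul_right]
    ring
  have hlin := nonneg_of_forall_mul_add_sq_mul_nonneg fun t ht0 ht1 => by
    have := hmin _ (hΩ.add_smul_sub_mem hx hy ⟨ht0.le, ht1⟩)
    rw [expand t] at this
    exact le_of_add_le_add_left ((add_zero _).trans_le this)
  have h1 := expand 1
  rw [one_smul, add_sub_cancel] at h1
  linarith [hA (y - x)]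

/-- Difference of the values of a quadratic form at two points of a ball. -/
theorem inner_map_self_sub_inner_map_self_le (A : E →L[ℝ] E) {x y : E} {C : ℝ}
    (hx : ‖x‖ ≤ C) (hy : ‖y‖ ≤ C) :
    ⟪x, A x⟫ - ⟪y, A y⟫ ≤ 2 * C * ‖A‖ * ‖y - x‖ := by
  have hsplit : ⟪x, A x⟫ - ⟪y, A y⟫ = ⟪x - y, A x⟫ + ⟪y, A (x - y)⟫ := by
    simp only [map_sub, inner_sub_left, inner_sub_right]
    ring
  have h1 : ⟪x - y, A x⟫ ≤ ‖x - y‖ * (‖A‖ * C) :=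
    (real_inner_le_norm _ _).trans <| by
      gcongr
      exact A.le_opNorm_of_le hx
  have h2 : ⟪y, A (x - y)⟫ ≤ C * (‖A‖ * ‖x - y‖) :=
    (real_inner_le_norm _ _).trans <|
      mul_le_mul hy (A.le_opNorm _) (norm_nonneg _) ((norm_nonneg y).trans hy)
  rw [hsplit, norm_sub_rev y x]
  linarith

end QuadraticProgram

/-- Lipschitz continuity of the minimizer of a parametric strongly convex quadratic
program in the weights: with `Ω ⊆ ℝⁿ` nonempty, closed, convex, contained in the ball
of radius `C`, linear maps `w ↦ D(w)` (symmetric positive semidefinite for `w ≥ 0`,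
with `‖D(w)‖ ≤ ‖w‖`) and `w ↦ c(w)` (with `‖c(w)‖ ≤ ‖w‖`), the minimizer `ν⋆(w)` of
`ν ↦ ⟨ν, D(w)ν⟩ + ε‖ν‖² + ⟨c(w), ν⟩` over `Ω` satisfies
`‖ν⋆(w₂) - ν⋆(w₁)‖ ≤ ((1 + 2C)/ε)‖w₂ - w₁‖` for nonnegative `w₁, w₂`. -/
theorem qp_minimizer_lipschitz_in_weights {n r : ℕ} (hn : 0 < n) (hr : 0 < r)
    (C ε : ℝ) (hC : 0 < C) (hε : 0 < ε)
    (Ω : Set (EuclideanSpace ℝ (Fin n)))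
    (hΩne : Ω.Nonempty) (hΩclosed : IsClosed Ω) (hΩconv : Convex ℝ Ω)
    (hΩbdd : Ω ⊆ Metric.closedBall 0 C)
    (D : EuclideanSpace ℝ (Fin r) →ₗ[ℝ]
      (EuclideanSpace ℝ (Fin n) →L[ℝ] EuclideanSpace ℝ (Fin n)))
    (c : EuclideanSpace ℝ (Fin r) →ₗ[ℝ] EuclideanSpace ℝ (Fin n))
    (hDsymm : ∀ w : EuclideanSpace ℝ (Fin r), (∀ i, 0 ≤ w i) →
      ∀ ν ν' : EuclideanSpace ℝ (Fin n), ⟪(D w) ν, ν'⟫ = ⟪ν, (D w) ν'⟫)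
    (hDpsd : ∀ w : EuclideanSpace ℝ (Fin r), (∀ i, 0 ≤ w i) →
      ∀ ν : EuclideanSpace ℝ (Fin n), 0 ≤ ⟪(D w) ν, ν⟫)
    (hDnorm : ∀ w : EuclideanSpace ℝ (Fin r), ‖D w‖ ≤ ‖w‖)
    (hcnorm : ∀ w : EuclideanSpace ℝ (Fin r), ‖c w‖ ≤ ‖w‖)
    (νstar : EuclideanSpace ℝ (Fin r) → EuclideanSpace ℝ (Fin n))
    (hνstar : ∀ w : EuclideanSpace ℝ (Fin r), (∀ i, 0 ≤ w i) →
      νstar w ∈ Ω ∧ ∀ ν ∈ Ω,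
        ⟪νstar w, (D w) (νstar w)⟫ + ε * ‖νstar w‖ ^ 2 + ⟪c w, νstar w⟫
          ≤ ⟪ν, (D w) ν⟫ + ε * ‖ν‖ ^ 2 + ⟪c w, ν⟫) :
    ∀ w₁ w₂ : EuclideanSpace ℝ (Fin r), (∀ i, 0 ≤ w₁ i) → (∀ i, 0 ≤ w₂ i) →
      ‖νstar w₂ - νstar w₁‖ ≤ ((1 + 2 * C) / ε) * ‖w₂ - w₁‖ := by
  intro w₁ w₂ hw₁ hw₂
  obtain ⟨hx, hxmin⟩ := hνstar w₁ hw₁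
  obtain ⟨hy, hymin⟩ := hνstar w₂ hw₂
  set x := νstar w₁
  set y := νstar w₂
  have hgx := quadratic_growth_of_minimizer hΩconv (hDpsd w₁ hw₁) hx hy hxmin
  have hgy := quadratic_growth_of_minimizer hΩconv (hDpsd w₂ hw₂) hy hx hymin
  rw [norm_sub_rev x y] at hgy
  have hquad := inner_map_self_sub_inner_map_self_le (D (w₂ - w₁))
    (mem_closedBall_zero_iff.1 (hΩbdd hx)) (mem_closedBall_zero_iff.1 (hΩbdd hy))
  have hlin : ⟪c (w₂ - w₁), x - y⟫ ≤ ‖w₂ - w₁‖ * ‖y - x‖ := by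
    rw [norm_sub_rev y x]
    exact (real_inner_le_norm _ _).trans (by gcongr; exact hcnorm _)
  have hD : 2 * C * ‖D (w₂ - w₁)‖ * ‖y - x‖ ≤ 2 * C * ‖w₂ - w₁‖ * ‖y - x‖ := by
    gcongr
    exact hDnorm _
  simp only [map_sub, sub_apply, inner_sub_left, inner_sub_right]
    at hquad hlin hD
  have hsq : ε * ‖y - x‖ * ‖y - x‖ ≤ (1 + 2 * C) * ‖w₂ - w₁‖ * ‖y - x‖ := by
    nlinarith [mul_nonneg hε.le (sq_nonneg ‖y - x‖)]
  rw [div_mul_eq_mul_div, le_div_iff₀' hε]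
  rcases (norm_nonneg (y - x)).eq_or_lt with h0 | hpos
  · rw [← h0, mul_zero]
    positivity
  · exact le_of_mul_le_mul_right hsq hpos
end
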